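/- arXiv:2410.21619 — 4 statements merged into one kernel-verified Lean document; each statement's English description precedes it below -/
import Mathlib

section
/- Let a, b ∈ (0,1) be real numbers with a ≠ b, and define D_n(a,b) := (a(1-b)^{n+1} - b(1-a)^{n+1})/(a-b), x_n := a(1-b)^n / D_n(a,b), y_n := b(1-a)^n / D_n(a,b) for n ≥ 0. Then for all n ≥ 1, x_{n+1} = x_n(1 - y_n)/(1 - x_n y_n) and y_{n+1} = y_n(1 - x_n)/(1 - x_n y_n). -/
theorem mul_one_sub_pow_sub_ne_zero {a b : ℝ} (ha : a ∈ Set.Ioo (0 : ℝ) 1)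
    (hb : b ∈ Set.Ioo (0 : ℝ) 1) (hab : a ≠ b) (n : ℕ) :
    a * (1 - b) ^ n - b * (1 - a) ^ n ≠ 0 := by
  obtain ⟨ha0, ha1⟩ := ha
  obtain ⟨hb0, hb1⟩ := hb
  have hp : 0 < (1 - b) ^ n := pow_pos (by linarith) n
  have hq : 0 < (1 - a) ^ n := pow_pos (by linarith) n
  rcases lt_or_gt_of_ne hab with h | h
  · have hpq : (1 - b) ^ n ≤ (1 - a) ^ n := pow_le_pow_left₀ (by linarith) (by linarith) n
    nlinarith
  · have hpq : (1 - a) ^ n ≤ (1 - b) ^ n := pow_le_pow_left₀ (by linarith) (by linarith) n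
    nlinarith

theorem div_eq_of_sub_eq_mul {u v c E D F : ℝ} (hE : E ≠ 0) (hD : D ≠ 0) (hF : F ≠ 0)
    (hv : D - v = c * E) (huv : D ^ 2 - u * v = E * F) :
    u * c / F = u / D * (1 - v / D) / (1 - u / D * (v / D)) := by
  have h₁ : 1 - v / D = c * E / D := by rw [← hv]; field_simp
  have h₂ : 1 - u / D * (v / D) = E * F / D ^ 2 := by rw [← huv]; field_simp
  rw [h₁, h₂]
  field_simp

theorem stmt_0 (a b : ℝ) (ha : a ∈ Set.Ioo (0 : ℝ) 1) (hb : b ∈ Set.Ioo (0 : ℝ) 1)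
    (hab : a ≠ b) (D x y : ℕ → ℝ)
    (hD : ∀ n : ℕ, D n = (a * (1 - b) ^ (n + 1) - b * (1 - a) ^ (n + 1)) / (a - b))
    (hx : ∀ n : ℕ, x n = a * (1 - b) ^ n / D n)
    (hy : ∀ n : ℕ, y n = b * (1 - a) ^ n / D n) :
    ∀ n : ℕ, 1 ≤ n →
      x (n + 1) = x n * (1 - y n) / (1 - x n * y n) ∧
      y (n + 1) = y n * (1 - x n) / (1 - x n * y n) := by
  intro n _
  have hsub : a - b ≠ 0 := sub_ne_zero.mpr hab
  have hne := mul_one_sub_pow_sub_ne_zero ha hb hab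
  have hD0 : ∀ m, D m ≠ 0 := fun m => by
    rw [hD]
    exact div_ne_zero (hne (m + 1)) hsub
  have hE0 := div_ne_zero (hne n) hsub
  have hyD : D n - b * (1 - a) ^ n =
      (1 - b) * ((a * (1 - b) ^ n - b * (1 - a) ^ n) / (a - b)) := by
    rw [hD]
    field_simp
    ring
  have hxD : D n - a * (1 - b) ^ n =
      (1 - a) * ((a * (1 - b) ^ n - b * (1 - a) ^ n) / (a - b)) := by
    rw [hD]
    field_simp
    ring
  have hxy : D n ^ 2 - a * (1 - b) ^ n * (b * (1 - a) ^ n) =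
      (a * (1 - b) ^ n - b * (1 - a) ^ n) / (a - b) * D (n + 1) := by
    rw [hD, hD]
    field_simp
    ring
  rw [hx (n + 1), hy (n + 1), hx n, hy n]
  constructor
  · rw [pow_succ, ← mul_assoc]
    exact div_eq_of_sub_eq_mul hE0 (hD0 n) (hD0 (n + 1)) hyD hxy
  · rw [pow_succ, ← mul_assoc, mul_comm (a * (1 - b) ^ n / D n) (b * (1 - a) ^ n / D n)]
    exact div_eq_of_sub_eq_mul hE0 (hD0 n) (hD0 (n + 1)) hxD (by rw [← hxy]; ring)
end

section
/- Let a, b ∈ (0,1) be real numbers with a ≠ b, and define x_n := a(a-b)(1-b)^n/(a(1-b)^{n+1} - b(1-a)^{n+1}) and y_n := b(a-b)(1-a)^n/(a(1-b)^{n+1} - b(1-a)^{n+1}) for n ≥ 0. Then 0 < x_n < 1 and 0 < y_n < 1 for all n ≥ 0. -/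
theorem mem_Ioo_of_lt {a b : ℝ} (hb : 0 < b) (hba : b < a) (ha : a < 1) (n : ℕ) :
    a * (a - b) * (1 - b) ^ n / (a * (1 - b) ^ (n + 1) - b * (1 - a) ^ (n + 1)) ∈
        Set.Ioo (0 : ℝ) 1 ∧
      b * (a - b) * (1 - a) ^ n / (a * (1 - b) ^ (n + 1) - b * (1 - a) ^ (n + 1)) ∈
        Set.Ioo (0 : ℝ) 1 := by
  have hp : 0 < 1 - b := by linarith
  have hq : 0 < 1 - a := by linarith
  have hab : 0 < a - b := sub_pos.2 hba
  have ha0 : 0 < a := hb.trans hba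
  have hpow : (1 - a) ^ n ≤ (1 - b) ^ n := pow_le_pow_left₀ hq.le (by linarith) n
  have key : b * (1 - a) ^ n < a * (1 - b) ^ n :=
    mul_lt_mul hba hpow (pow_pos hq n) ha0.le
  have hx0 : 0 < a * (a - b) * (1 - b) ^ n := by positivity
  have hy0 : 0 < b * (a - b) * (1 - a) ^ n := by positivity
  have hx1 : a * (a - b) * (1 - b) ^ n < a * (1 - b) ^ (n + 1) - b * (1 - a) ^ (n + 1) := by
    have h := mul_lt_mul_of_pos_left key hq
    rw [pow_succ, pow_succ]
    linarith
  have hy1 : b * (a - b) * (1 - a) ^ n < a * (1 - b) ^ (n + 1) - b * (1 - a) ^ (n + 1) := by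
    have h := mul_lt_mul_of_pos_left key hp
    rw [pow_succ, pow_succ]
    linarith
  have hd := hx0.trans hx1
  exact ⟨⟨div_pos hx0 hd, (div_lt_one hd).2 hx1⟩, ⟨div_pos hy0 hd, (div_lt_one hd).2 hy1⟩⟩

theorem stmt_3 (a b : ℝ) (ha : a ∈ Set.Ioo (0 : ℝ) 1) (hb : b ∈ Set.Ioo (0 : ℝ) 1)
    (hab : a ≠ b) (x y : ℕ → ℝ)
    (hx : ∀ n : ℕ, x n = a * (a - b) * (1 - b) ^ n /
      (a * (1 - b) ^ (n + 1) - b * (1 - a) ^ (n + 1)))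
    (hy : ∀ n : ℕ, y n = b * (a - b) * (1 - a) ^ n /
      (a * (1 - b) ^ (n + 1) - b * (1 - a) ^ (n + 1))) :
    ∀ n : ℕ, (0 < x n ∧ x n < 1) ∧ (0 < y n ∧ y n < 1) := by
  intro n
  rw [hx, hy]
  rcases hab.lt_or_gt with h | h
  · obtain ⟨h₁, h₂⟩ := mem_Ioo_of_lt ha.1 h hb.2 n
    rw [← neg_div_neg_eq] at h₁ h₂
    rw [neg_sub, ← neg_mul, ← mul_neg, neg_sub] at h₁ h₂
    exact ⟨h₂, h₁⟩
  · exact mem_Ioo_of_lt hb.1 h ha.2 n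
end

section
/- Let a, b ∈ (0,1) be real numbers with a ≠ b. Then ∑_{n=0}^{∞} L( a·b·(a-b)²·(1-a)^n·(1-b)^n / (a(1-b)^{n+1} - b(1-a)^{n+1})² ) = L(a) + L(b) - L( |a-b| / (1 - min(a,b)) ). -/
/-- The Rogers dilogarithm on `[0,1]`: `L(x) = Li₂(x) + (1/2)·log x · log (1-x)`
for `0 < x < 1`, with `L 0 = 0` and `L 1 = π²/6`. -/
noncomputable def rogersL (x : ℝ) : ℝ :=
  if x = 0 then 0
  else if x = 1 then Real.pi ^ 2 / 6
  else (∑' n : ℕ, x ^ (n + 1) / ((n : ℝ) + 1) ^ 2) + 1 / 2 * Real.log x * Real.log (1 - x)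

open Filter Topology

lemma rogersL_eq_of_ne_one {x : ℝ} (hx : x ≠ 1) :
    rogersL x =
      (∑' n : ℕ, x ^ (n + 1) / ((n : ℝ) + 1) ^ 2) + 1 / 2 * Real.log x * Real.log (1 - x) := by
  by_cases h0 : x = 0
  · simp [rogersL, h0]
  · simp [rogersL, h0, hx]

lemma rogersL_nonneg {x : ℝ} (h0 : 0 < x) (h1 : x < 1) : 0 ≤ rogersL x := by
  rw [rogersL_eq_of_ne_one h1.ne]
  have hsum : 0 ≤ ∑' n : ℕ, x ^ (n + 1) / ((n : ℝ) + 1) ^ 2 :=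
    tsum_nonneg fun n => by positivity
  have hlog : 0 ≤ Real.log x * Real.log (1 - x) :=
    mul_nonneg_of_nonpos_of_nonpos (Real.log_nonpos h0.le h1.le)
      (Real.log_nonpos (by linarith) (by linarith))
  linarith

lemma hasDerivAt_tsum_pow_div_sq {x : ℝ} (hx : |x| < 1) :
    HasDerivAt (fun y : ℝ => ∑' n : ℕ, y ^ (n + 1) / ((n : ℝ) + 1) ^ 2)
      (∑' n : ℕ, x ^ n / ((n : ℝ) + 1)) x := by
  obtain ⟨r, hxr, hr1⟩ := exists_between hx
  have hr0 : 0 < r := (abs_nonneg x).trans_lt hxr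
  refine hasDerivAt_tsum_of_isPreconnected (u := fun n : ℕ => r ^ n) (t := Metric.ball 0 r)
    (y₀ := 0) (g := fun (n : ℕ) y => y ^ (n + 1) / ((n : ℝ) + 1) ^ 2)
    (g' := fun (n : ℕ) y => y ^ n / ((n : ℝ) + 1))
    (summable_geometric_of_lt_one hr0.le hr1) Metric.isOpen_ball
    (convex_ball _ _).isPreconnected ?_ ?_ (by simpa using hr0) ?_ (by simpa using hxr)
  · intro n y _
    have h := (hasDerivAt_pow (n + 1) y).div_const (((n : ℝ) + 1) ^ 2)
    refine h.congr_deriv ?_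
    have : (n : ℝ) + 1 ≠ 0 := by positivity
    push_cast
    field_simp
  · intro n y hy
    have hy' : |y| ≤ r := by simpa using (Metric.mem_ball.1 hy).le
    have hn : (1 : ℝ) ≤ (n : ℝ) + 1 := by simp
    rw [norm_div, norm_pow, Real.norm_eq_abs, Real.norm_of_nonneg (by positivity)]
    calc |y| ^ n / ((n : ℝ) + 1) ≤ |y| ^ n := div_le_self (by positivity) hn
      _ ≤ r ^ n := by gcongr
  · simp

lemma tsum_pow_div_eq {x : ℝ} (h0 : x ≠ 0) (hx : |x| < 1) :
    ∑' n : ℕ, x ^ n / ((n : ℝ) + 1) = -Real.log (1 - x) / x := by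
  rw [← (Real.hasSum_pow_div_log_of_abs_lt_one hx).tsum_eq, ← tsum_div_const]
  refine tsum_congr fun n => ?_
  field_simp
  ring

lemma hasDerivAt_rogersL {x : ℝ} (h0 : 0 < x) (h1 : x < 1) :
    HasDerivAt rogersL (-Real.log (1 - x) / (2 * x) - Real.log x / (2 * (1 - x))) x := by
  have hx : |x| < 1 := by rwa [abs_of_pos h0]
  have h1x : 1 - x ≠ 0 := by linarith
  have hlog := (Real.hasDerivAt_log h0.ne').const_mul (1 / 2)
  have hlog' := ((hasDerivAt_id x).const_sub 1).log h1x
  have h := (hasDerivAt_tsum_pow_div_sq hx).add (hlog.mul hlog')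
  refine (h.congr_of_eventuallyEq ((eventually_ne_nhds h1.ne).mono fun y hy => ?_)).congr_deriv ?_
  · simp [rogersL_eq_of_ne_one hy]
  rw [tsum_pow_div_eq h0.ne' hx]
  simp only [id]
  field_simp
  ring

lemma continuousAt_rogersL_zero : ContinuousAt rogersL 0 := by
  have hd : DifferentiableAt ℝ (fun x : ℝ => Real.log (1 - x)) 0 :=
    ((differentiableAt_id).const_sub 1).log (by simp)
  have hslope := continuousAt_dslope_same.2 hd
  have h := (hasDerivAt_tsum_pow_div_sq (x := 0) (by simp)).continuousAt.add
    ((continuousAt_const (y := (1 / 2 : ℝ))).mul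
      (Real.continuous_mul_log.continuousAt.mul hslope))
  refine h.congr ((eventually_ne_nhds (zero_ne_one' ℝ)).mono fun x hx => ?_)
  have hmul := sub_smul_dslope (fun x : ℝ => Real.log (1 - x)) 0 x
  simp only [sub_zero, Real.log_one, smul_eq_mul] at hmul
  rw [rogersL_eq_of_ne_one hx, ← hmul]
  simp only [Pi.add_apply, Pi.mul_apply]
  ring

lemma continuousAt_rogersL {x : ℝ} (h0 : 0 ≤ x) (h1 : x < 1) : ContinuousAt rogersL x := by
  rcases h0.eq_or_lt with rfl | h0
  · exact continuousAt_rogersL_zero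
  · exact (hasDerivAt_rogersL h0 h1).continuousAt

/-- The five-term relation of Abel. -/
lemma rogersL_add_rogersL {x y : ℝ} (hx0 : 0 < x) (hx1 : x < 1) (hy0 : 0 < y) (hy1 : y < 1) :
    rogersL x + rogersL y = rogersL (x * y) + rogersL (x * (1 - y) / (1 - x * y)) +
      rogersL (y * (1 - x) / (1 - x * y)) := by
  have hz : rogersL 0 = 0 := by simp [rogersL]
  let F : ℝ → ℝ := fun t => rogersL (t * y) + rogersL (t * (1 - y) / (1 - t * y)) +
      rogersL (y * (1 - t) / (1 - t * y)) - rogersL t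
  have hpos : ∀ t, 0 ≤ t → t < 1 → 0 < 1 - t * y := fun t h0 h1 => by nlinarith
  have hcont : ContinuousOn F (Set.Icc 0 x) := by
    intro t ht
    have ht0 := ht.1
    have ht1 : t < 1 := ht.2.trans_lt hx1
    have hp := hpos t ht0 ht1
    have h1y : 0 ≤ 1 - y := by linarith
    have h1t : 0 ≤ 1 - t := by linarith
    have c1 : ContinuousAt (fun t : ℝ => t * y) t := by fun_prop
    have c2 : ContinuousAt (fun t : ℝ => t * (1 - y) / (1 - t * y)) t := by
      fun_prop (disch := exact hp.ne')
    have c3 : ContinuousAt (fun t : ℝ => y * (1 - t) / (1 - t * y)) t := by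
      fun_prop (disch := exact hp.ne')
    refine ContinuousAt.continuousWithinAt (ContinuousAt.sub (ContinuousAt.add
      (ContinuousAt.add ?_ ?_) ?_) (continuousAt_rogersL ht0 ht1))
    · exact ContinuousAt.comp' (continuousAt_rogersL (by positivity) (by linarith)) c1
    · exact ContinuousAt.comp' (continuousAt_rogersL (by positivity)
        (by rw [div_lt_one hp]; linarith)) c2
    · exact ContinuousAt.comp' (continuousAt_rogersL (by positivity)
        (by rw [div_lt_one hp]; linarith)) c3
  have hderiv : ∀ t ∈ Set.Ioo 0 x, HasDerivAt F 0 t := by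
    intro t ht
    have ht0 := ht.1
    have ht1 : t < 1 := ht.2.trans hx1
    have hp := hpos t ht0.le ht1
    have h1y : 0 < 1 - y := by linarith
    have h1t : 0 < 1 - t := by linarith
    have dmul := (hasDerivAt_id t).mul_const y
    have dden := dmul.const_sub 1
    have d2 := ((hasDerivAt_id t).mul_const (1 - y)).div dden hp.ne'
    have d3 := (((hasDerivAt_id t).const_sub 1).const_mul y).div dden hp.ne'
    have e1 := (hasDerivAt_rogersL (x := t * y) (by positivity) (by linarith)).comp t dmul
    have e2 := (hasDerivAt_rogersL (x := t * (1 - y) / (1 - t * y)) (by positivity)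
      (by rw [div_lt_one hp]; linarith)).comp t d2
    have e3 := (hasDerivAt_rogersL (x := y * (1 - t) / (1 - t * y)) (by positivity)
      (by rw [div_lt_one hp]; linarith)).comp t d3
    refine (((e1.add e2).add e3).sub (hasDerivAt_rogersL ht0 ht1)).congr_deriv ?_
    have hp' := hp.ne'
    have h1y' := h1y.ne'
    have h1t' := h1t.ne'
    have q2 : 1 - t * (1 - y) / (1 - t * y) = (1 - t) / (1 - t * y) := by
      rw [eq_div_iff hp', sub_mul, div_mul_cancel₀ _ hp']
      ring
    have q3 : 1 - y * (1 - t) / (1 - t * y) = (1 - y) / (1 - t * y) := by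
      rw [eq_div_iff hp', sub_mul, div_mul_cancel₀ _ hp']
      ring
    simp only [q2, q3, id]
    rw [Real.log_div h1t.ne' hp.ne', Real.log_div h1y.ne' hp.ne',
      Real.log_div (by positivity) hp.ne', Real.log_div (by positivity) hp.ne',
      Real.log_mul ht0.ne' hy0.ne', Real.log_mul ht0.ne' h1y.ne',
      Real.log_mul hy0.ne' h1t.ne']
    generalize Real.log (1 - t * y) = l1
    generalize Real.log (1 - t) = l2
    generalize Real.log (1 - y) = l3
    generalize Real.log t = l4
    generalize Real.log y = l5
    field_simp
    ring
  obtain ⟨c, _, hc⟩ := exists_hasDerivAt_eq_slope F (fun _ => 0) hx0 hcont hderiv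
  have hF : F x = F 0 := by
    rw [eq_div_iff (by linarith)] at hc
    linarith
  simp only [F, zero_mul, sub_zero, mul_one, div_one, hz] at hF
  linarith

lemma rogersL_recurrence {a b s t : ℝ} (ha : 0 < a) (hab : a < b) (hb : b < 1)
    (ht : 0 < t) (hts : t ≤ s) :
    rogersL (a * b * (a - b) ^ 2 * s * t / (a * (t * (1 - b)) - b * (s * (1 - a))) ^ 2) =
      rogersL (a * (b - a) * t / (b * (s * (1 - a)) - a * (t * (1 - b)))) +
      rogersL (b * (b - a) * s / (b * (s * (1 - a)) - a * (t * (1 - b)))) -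
      (rogersL (a * (b - a) * (t * (1 - b)) /
          (b * (s * (1 - a) * (1 - a)) - a * (t * (1 - b) * (1 - b)))) +
        rogersL (b * (b - a) * (s * (1 - a)) /
          (b * (s * (1 - a) * (1 - a)) - a * (t * (1 - b) * (1 - b))))) ∧
    0 ≤ rogersL (a * b * (a - b) ^ 2 * s * t /
      (a * (t * (1 - b)) - b * (s * (1 - a))) ^ 2) := by
  have hb0 : 0 < b := ha.trans hab
  have hs : 0 < s := ht.trans_le hts
  have hba : 0 < b - a := by linarith
  have h1a : 0 < 1 - a := by linarith
  have h1b : 0 < 1 - b := by linarith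
  have hC : 0 < b * s - a * t := by
    have := mul_lt_mul hab hts ht hb0.le
    linarith
  have ht' : t * (1 - b) < s * (1 - a) := mul_lt_mul' hts (by linarith) h1b.le hs
  have hD : 0 < b * (s * (1 - a)) - a * (t * (1 - b)) := by
    have := mul_lt_mul hab ht'.le (by positivity) hb0.le
    linarith
  have hE : 0 < b * (s * (1 - a) * (1 - a)) - a * (t * (1 - b) * (1 - b)) := by
    have h := mul_lt_mul' ht'.le (show 1 - b < 1 - a by linarith) h1b.le (by positivity)
    have := mul_lt_mul hab h.le (by positivity) hb0.le
    linarith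
  set D := b * (s * (1 - a)) - a * (t * (1 - b)) with hDdef
  set E := b * (s * (1 - a) * (1 - a)) - a * (t * (1 - b) * (1 - b)) with hEdef
  have hA1 : 1 - a * (b - a) * t / D = (1 - a) * (b * s - a * t) / D := by
    rw [eq_div_iff hD.ne', sub_mul, div_mul_cancel₀ _ hD.ne', hDdef]; ring
  have hB1 : 1 - b * (b - a) * s / D = (1 - b) * (b * s - a * t) / D := by
    rw [eq_div_iff hD.ne', sub_mul, div_mul_cancel₀ _ hD.ne', hDdef]; ring
  have hAB : 1 - a * (b - a) * t / D * (b * (b - a) * s / D) =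
      (b * s - a * t) * E / D ^ 2 := by
    rw [eq_div_iff (by positivity), sub_mul, div_mul_div_comm, ← pow_two,
      div_mul_cancel₀ _ (by positivity), hDdef, hEdef]; ring
  have hA0 : 0 < a * (b - a) * t / D := by positivity
  have hB0 : 0 < b * (b - a) * s / D := by positivity
  have hAlt : a * (b - a) * t / D < 1 := by
    have : 0 < (1 - a) * (b * s - a * t) / D := by positivity
    linarith
  have hBlt : b * (b - a) * s / D < 1 := by
    have : 0 < (1 - b) * (b * s - a * t) / D := by positivity
    linarith
  have h := rogersL_add_rogersL hA0 hAlt hB0 hBlt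
  have hprod : a * b * (a - b) ^ 2 * s * t / (a * (t * (1 - b)) - b * (s * (1 - a))) ^ 2 =
      a * (b - a) * t / D * (b * (b - a) * s / D) := by
    rw [div_mul_div_comm, ← pow_two, ← neg_sq (a * (t * (1 - b)) - b * (s * (1 - a))),
      neg_sub, ← hDdef]
    ring
  have hD' := hD.ne'
  have hE' := hE.ne'
  have hC' := hC.ne'
  have hA' : a * (b - a) * t / D * ((1 - b) * (b * s - a * t) / D) /
      ((b * s - a * t) * E / D ^ 2) = a * (b - a) * (t * (1 - b)) / E := by
    clear_value D E
    field_simp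
  have hB' : b * (b - a) * s / D * ((1 - a) * (b * s - a * t) / D) /
      ((b * s - a * t) * E / D ^ 2) = b * (b - a) * (s * (1 - a)) / E := by
    clear_value D E
    field_simp
  rw [hAB, hA1, hB1, hA', hB'] at h
  rw [hprod]
  exact ⟨by linarith, rogersL_nonneg (by positivity)
    (mul_lt_one_of_nonneg_of_lt_one_left hA0.le hAlt hBlt.le)⟩

lemma hasSum_rogersL_of_lt {a b : ℝ} (ha : 0 < a) (hab : a < b) (hb : b < 1) :
    HasSum (fun n : ℕ => rogersL (a * b * (a - b) ^ 2 * (1 - a) ^ n * (1 - b) ^ n /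
        (a * (1 - b) ^ (n + 1) - b * (1 - a) ^ (n + 1)) ^ 2))
      (rogersL a + rogersL b - rogersL ((b - a) / (1 - a))) := by
  have hz : rogersL 0 = 0 := by simp [rogersL]
  have hb0 : 0 < b := ha.trans hab
  have hba : 0 < b - a := by linarith
  have h1a : 0 < 1 - a := by linarith
  have h1b : 0 < 1 - b := by linarith
  let A : ℕ → ℝ := fun n => a * (b - a) * (1 - b) ^ n /
    (b * (1 - a) ^ (n + 1) - a * (1 - b) ^ (n + 1))
  let B : ℕ → ℝ := fun n => b * (b - a) * (1 - a) ^ n /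
    (b * (1 - a) ^ (n + 1) - a * (1 - b) ^ (n + 1))
  have hrec := fun n : ℕ => rogersL_recurrence (s := (1 - a) ^ n) (t := (1 - b) ^ n) ha hab hb
    (by positivity) (pow_le_pow_left₀ h1b.le (by linarith) n)
  simp only [← pow_succ] at hrec
  rw [hasSum_iff_tendsto_nat_of_nonneg fun n => (hrec n).2]
  have hpartial : ∀ N : ℕ, ∑ n ∈ Finset.range N,
      rogersL (a * b * (a - b) ^ 2 * (1 - a) ^ n * (1 - b) ^ n /
        (a * (1 - b) ^ (n + 1) - b * (1 - a) ^ (n + 1)) ^ 2) =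
      rogersL a + rogersL b - (rogersL (A N) + rogersL (B N)) := by
    intro N
    have hA0 : A 0 = a := by
      simp only [A, pow_zero, zero_add, pow_one]
      rw [div_eq_iff (by nlinarith)]; ring
    have hB0 : B 0 = b := by
      simp only [B, pow_zero, zero_add, pow_one]
      rw [div_eq_iff (by nlinarith)]; ring
    have h := Finset.sum_range_sub' (fun n => rogersL (A n) + rogersL (B n)) N
    rw [hA0, hB0] at h
    rw [← h]
    exact Finset.sum_congr rfl fun n _ => (hrec n).1
  simp only [hpartial]
  have hρ : Tendsto (fun n : ℕ => ((1 - b) / (1 - a)) ^ n) atTop (𝓝 0) :=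
    tendsto_pow_atTop_nhds_zero_of_lt_one (by positivity) (by rw [div_lt_one h1a]; linarith)
  have hden : Tendsto (fun n : ℕ => b * (1 - a) - a * (1 - b) * ((1 - b) / (1 - a)) ^ n) atTop
      (𝓝 (b * (1 - a))) := by
    simpa using (hρ.const_mul (a * (1 - b))).const_sub (b * (1 - a))
  have hne : b * (1 - a) ≠ 0 := by positivity
  have hA : Tendsto A atTop (𝓝 0) := by
    have h := (hρ.const_mul (a * (b - a))).div hden hne
    simp only [mul_zero, zero_div] at h
    refine h.congr fun n => ?_
    rw [Pi.div_apply, ← mul_div_mul_right _ _ (pow_pos h1a n).ne']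
    simp only [A, div_pow]
    congr 1
    · field_simp
    · field_simp
      ring
  have hB : Tendsto B atTop (𝓝 ((b - a) / (1 - a))) := by
    have h := (tendsto_const_nhds (x := b * (b - a))).div hden hne
    rw [mul_div_mul_left _ _ hb0.ne'] at h
    refine h.congr fun n => ?_
    rw [Pi.div_apply, ← mul_div_mul_right _ _ (pow_pos h1a n).ne']
    simp only [B, div_pow]
    congr 1
    field_simp
    ring
  have hLA := (continuousAt_rogersL le_rfl one_pos).tendsto.comp hA
  have hLB := (continuousAt_rogersL (x := (b - a) / (1 - a)) (by positivity)
    (by rw [div_lt_one h1a]; linarith)).tendsto.comp hB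
  simpa [hz] using (hLA.add hLB).const_sub (rogersL a + rogersL b)

theorem stmt_5 (a b : ℝ) (ha : a ∈ Set.Ioo (0 : ℝ) 1) (hb : b ∈ Set.Ioo (0 : ℝ) 1)
    (hab : a ≠ b) :
    ∑' n : ℕ, rogersL (a * b * (a - b) ^ 2 * (1 - a) ^ n * (1 - b) ^ n /
        (a * (1 - b) ^ (n + 1) - b * (1 - a) ^ (n + 1)) ^ 2) =
      rogersL a + rogersL b - rogersL (|a - b| / (1 - min a b)) := by
  rcases hab.lt_or_gt with h | h
  · rw [(hasSum_rogersL_of_lt ha.1 h hb.2).tsum_eq, min_eq_left h.le, abs_sub_comm,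
      abs_of_pos (sub_pos.2 h)]
  · rw [min_eq_right h.le, abs_of_pos (sub_pos.2 h), add_comm (rogersL a),
      ← (hasSum_rogersL_of_lt hb.1 h ha.2).tsum_eq]
    refine tsum_congr fun n => congrArg rogersL ?_
    congr 1 <;> ring
end

section
/- Let F_n denote the Fibonacci numbers. Then ∑_{n=2}^{∞} L( 1 / F_{2n}² ) = L( 2 / (7 + 3√5) ). -/
open Real Set Filter Topology

lemma hasDerivAt_dilog_series {x : ℝ} (hx : |x| < 1) (hx0 : x ≠ 0) :
    HasDerivAt (fun z : ℝ => ∑' n : ℕ, z ^ (n + 1) / ((n : ℝ) + 1) ^ 2) (-log (1 - x) / x) x := by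
  obtain ⟨r, hxr, hr1⟩ := exists_between hx
  have hr0 : 0 < r := (abs_nonneg x).trans_lt hxr
  have key : HasDerivAt (fun z : ℝ => ∑' n : ℕ, z ^ (n + 1) / ((n : ℝ) + 1) ^ 2)
      (∑' n : ℕ, x ^ n / ((n : ℝ) + 1)) x := by
    refine hasDerivAt_tsum_of_isPreconnected (u := fun n : ℕ => r ^ n) (t := Metric.ball 0 r)
      (y₀ := 0) (g' := fun n z => z ^ n / ((n : ℝ) + 1))
      (summable_geometric_of_lt_one hr0.le hr1) Metric.isOpen_ball
      (convex_ball 0 r).isPreconnected ?_ ?_ (by simpa using hr0) (by simp [summable_zero])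
      (by simpa using hxr)
    · intro n z _
      refine ((hasDerivAt_pow (n + 1) z).div_const (((n : ℝ) + 1) ^ 2)).congr_deriv ?_
      rw [Nat.cast_add_one, Nat.add_sub_cancel]
      field_simp
    · intro n z hz
      have hz' : |z| < r := by simpa using hz
      rw [norm_div, norm_pow, Real.norm_eq_abs, Real.norm_eq_abs,
        abs_of_pos (by positivity : (0 : ℝ) < n + 1)]
      calc |z| ^ n / ((n : ℝ) + 1) ≤ |z| ^ n := div_le_self (by positivity) (by simp)
        _ ≤ r ^ n := by gcongr
  convert key using 1
  have h := (hasSum_pow_div_log_of_abs_lt_one hx).div_const x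
  rw [← h.tsum_eq]
  congr 1
  ext n
  rw [div_right_comm, pow_succ, mul_div_cancel_right₀ _ hx0]

lemma tendsto_dilog_series_zero :
    Tendsto (fun z : ℝ => ∑' n : ℕ, z ^ (n + 1) / ((n : ℝ) + 1) ^ 2) (𝓝 0) (𝓝 0) := by
  have h : ContinuousOn (fun z : ℝ => ∑' n : ℕ, z ^ (n + 1) / ((n : ℝ) + 1) ^ 2)
      (Metric.closedBall 0 (1 / 2)) := by
    refine continuousOn_tsum (u := fun n : ℕ => (1 / 2 : ℝ) ^ n) (fun n => by fun_prop)
      summable_geometric_two fun n z hz => ?_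
    have hz' : |z| ≤ 1 / 2 := by simpa using hz
    rw [norm_div, norm_pow, Real.norm_eq_abs, Real.norm_eq_abs,
      abs_of_pos (by positivity : (0 : ℝ) < ((n : ℝ) + 1) ^ 2)]
    calc |z| ^ (n + 1) / ((n : ℝ) + 1) ^ 2 ≤ |z| ^ (n + 1) :=
          div_le_self (by positivity) (one_le_pow₀ (by simp))
      _ ≤ |z| ^ n := pow_le_pow_of_le_one (abs_nonneg z) (by linarith) (by omega)
      _ ≤ (1 / 2) ^ n := by gcongr
  have h0 := (h.continuousAt (Metric.closedBall_mem_nhds 0 (by norm_num))).tendsto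
  simpa using h0

lemma rogersL_of_mem_Ioo {x : ℝ} (hx : x ∈ Ioo (0 : ℝ) 1) :
    rogersL x =
      (∑' n : ℕ, x ^ (n + 1) / ((n : ℝ) + 1) ^ 2) + 1 / 2 * log x * log (1 - x) := by
  rw [rogersL, if_neg hx.1.ne', if_neg hx.2.ne]

lemma rogersL_nonneg_s12 {x : ℝ} (hx : x ∈ Ioo (0 : ℝ) 1) : 0 ≤ rogersL x := by
  rw [rogersL_of_mem_Ioo hx]
  have h1 : 0 ≤ ∑' n : ℕ, x ^ (n + 1) / ((n : ℝ) + 1) ^ 2 :=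
    tsum_nonneg fun n => by have := hx.1; positivity
  have h2 : 0 ≤ log x * log (1 - x) :=
    mul_nonneg_of_nonpos_of_nonpos (log_nonpos hx.1.le hx.2.le)
      (log_nonpos (by linarith [hx.2]) (by linarith [hx.1]))
  linarith

lemma hasDerivAt_rogersL_s12 {x : ℝ} (hx : x ∈ Ioo (0 : ℝ) 1) :
    HasDerivAt rogersL (-(log (1 - x) / x + log x / (1 - x)) / 2) x := by
  have hx0 : x ≠ 0 := hx.1.ne'
  have hx1 : 1 - x ≠ 0 := by linarith [hx.2]
  have h1 := hasDerivAt_dilog_series (abs_lt.2 ⟨by linarith [hx.1], hx.2⟩) hx0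
  have h2 := ((hasDerivAt_log hx0).const_mul (1 / 2)).mul
    (((hasDerivAt_id x).const_sub 1).log hx1)
  have h3 := h1.add h2
  refine (h3.congr_of_eventuallyEq ?_).congr_deriv ?_
  · filter_upwards [isOpen_Ioo.mem_nhds hx] with z hz
    simpa using rogersL_of_mem_Ioo hz
  · simp only [id]
    field_simp
    ring

lemma tendsto_rogersL_zero : Tendsto rogersL (𝓝[>] 0) (𝓝 0) := by
  have h1 := tendsto_dilog_series_zero.mono_left (nhdsWithin_le_nhds (s := Ioi (0 : ℝ)))
  have h2 : Tendsto (fun x : ℝ => log x * x) (𝓝[>] 0) (𝓝 0) := by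
    simpa using tendsto_log_mul_rpow_nhdsGT_zero one_pos
  have h3 : Tendsto (fun x : ℝ => x⁻¹ * log (1 - x)) (𝓝[>] 0) (𝓝 (-1)) := by
    have h : HasDerivAt (fun x : ℝ => log (1 - x)) (-1) 0 := by
      simpa using ((hasDerivAt_id (0 : ℝ)).const_sub 1).log (by simp)
    simpa using (hasDerivAt_iff_tendsto_slope_zero.1 h).mono_left
      (nhdsWithin_mono 0 fun z (hz : z ∈ Ioi (0 : ℝ)) => ne_of_gt hz)
  have h4 := h1.add ((h2.mul h3).const_mul (1 / 2))
  simp only [zero_mul, mul_zero, add_zero] at h4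
  refine h4.congr' ?_
  filter_upwards [Ioo_mem_nhdsGT (zero_lt_one' ℝ)] with z hz
  rw [rogersL_of_mem_Ioo hz]
  have := hz.1.ne'
  field_simp

lemma rogersL_add_rogersL_one_sub {x y : ℝ} (hx : x ∈ Ioo (0 : ℝ) 1) (hy : y ∈ Ioo (0 : ℝ) 1) :
    rogersL x + rogersL (1 - x) = rogersL y + rogersL (1 - y) := by
  have hd : ∀ z ∈ Ioo (0 : ℝ) 1, HasDerivAt (fun z => rogersL z + rogersL (1 - z)) 0 z := by
    intro z hz
    have hz' : 1 - z ∈ Ioo (0 : ℝ) 1 := ⟨by linarith [hz.2], by linarith [hz.1]⟩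
    refine ((hasDerivAt_rogersL_s12 hz).add
      ((hasDerivAt_rogersL_s12 hz').comp z ((hasDerivAt_id z).const_sub 1))).congr_deriv ?_
    rw [sub_sub_cancel]
    ring
  exact isOpen_Ioo.is_const_of_deriv_eq_zero isPreconnected_Ioo
    (fun z hz => (hd z hz).differentiableAt.differentiableWithinAt)
    (fun z hz => (hd z hz).deriv) hx hy

/-- Abel's five-term relation. -/
lemma rogersL_five_term {x y : ℝ} (hx : x ∈ Ioo (0 : ℝ) 1) (hy : y ∈ Ioo (0 : ℝ) 1) :
    rogersL x + rogersL y = rogersL (x * y) + rogersL (x * (1 - y) / (1 - x * y)) +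
      rogersL (y * (1 - x) / (1 - x * y)) := by
  obtain ⟨hy0, hy1⟩ := hy
  have hy1' : 0 < 1 - y := by linarith
  have hxy : ∀ z ∈ Ioo (0 : ℝ) 1, 0 < 1 - z * y := fun z hz => by nlinarith [hz.1, hz.2]
  have hm : ∀ z ∈ Ioo (0 : ℝ) 1, z * y ∈ Ioo (0 : ℝ) 1 := fun z hz =>
    ⟨mul_pos hz.1 hy0, by linarith [hxy z hz]⟩
  have hu : ∀ z ∈ Ioo (0 : ℝ) 1, z * (1 - y) / (1 - z * y) ∈ Ioo (0 : ℝ) 1 := fun z hz =>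
    ⟨div_pos (mul_pos hz.1 hy1') (hxy z hz), by rw [div_lt_one (hxy z hz)]; linarith [hz.2]⟩
  have hv : ∀ z ∈ Ioo (0 : ℝ) 1, y * (1 - z) / (1 - z * y) ∈ Ioo (0 : ℝ) 1 := fun z hz =>
    ⟨div_pos (mul_pos hy0 (by linarith [hz.2])) (hxy z hz), by
      rw [div_lt_one (hxy z hz)]; linarith⟩
  set g : ℝ → ℝ := fun z => rogersL z - rogersL (z * y) - rogersL (z * (1 - y) / (1 - z * y)) -
    rogersL (y * (1 - z) / (1 - z * y)) with hg
  have hd : ∀ z ∈ Ioo (0 : ℝ) 1, HasDerivAt g 0 z := by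
    intro z hz
    have hz0 : z ≠ 0 := hz.1.ne'
    have hz1 : 1 - z ≠ 0 := by linarith [hz.2]
    have hq : 1 - z * y ≠ 0 := (hxy z hz).ne'
    have hq' : HasDerivAt (fun z : ℝ => 1 - z * y) (-y) z := by
      simpa using ((hasDerivAt_id z).mul_const y).const_sub 1
    have du : HasDerivAt (fun z : ℝ => z * (1 - y) / (1 - z * y))
        ((1 - y) / (1 - z * y) ^ 2) z := by
      refine (((hasDerivAt_id z).mul_const (1 - y)).div hq' hq).congr_deriv ?_
      simp only [id]
      ring
    have dv : HasDerivAt (fun z : ℝ => y * (1 - z) / (1 - z * y))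
        (-(y * (1 - y)) / (1 - z * y) ^ 2) z := by
      refine ((((hasDerivAt_id z).const_sub 1).const_mul y).div hq' hq).congr_deriv ?_
      simp only [id]
      ring
    have dm : HasDerivAt (fun z : ℝ => z * y) y z := by
      simpa using (hasDerivAt_id z).mul_const y
    refine ((((hasDerivAt_rogersL_s12 hz).sub ((hasDerivAt_rogersL_s12 (hm z hz)).comp z dm)).sub
      ((hasDerivAt_rogersL_s12 (hu z hz)).comp z du)).sub
      ((hasDerivAt_rogersL_s12 (hv z hz)).comp z dv)).congr_deriv ?_
    have eu : 1 - z * (1 - y) / (1 - z * y) = (1 - z) / (1 - z * y) := by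
      rw [eq_div_iff hq, sub_mul, div_mul_cancel₀ _ hq]
      ring
    have ev : 1 - y * (1 - z) / (1 - z * y) = (1 - y) / (1 - z * y) := by
      rw [eq_div_iff hq, sub_mul, div_mul_cancel₀ _ hq]
      ring
    have hyn := hy0.ne'
    have hyn' := hy1'.ne'
    rw [eu, ev, log_div hz1 hq, log_div hyn' hq, log_div (mul_ne_zero hz0 hyn') hq,
      log_div (mul_ne_zero hyn hz1) hq, log_mul hz0 hyn, log_mul hz0 hyn', log_mul hyn hz1]
    generalize log z = a
    generalize log y = b
    generalize log (1 - z) = c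
    generalize log (1 - y) = d
    generalize log (1 - z * y) = e
    field_simp
    ring
  have hconst : ∀ z ∈ Ioo (0 : ℝ) 1, g z = g x := fun z hz =>
    isOpen_Ioo.is_const_of_deriv_eq_zero isPreconnected_Ioo
      (fun z hz => (hd z hz).differentiableAt.differentiableWithinAt)
      (fun z hz => (hd z hz).deriv) hz hx
  have hI : Ioo (0 : ℝ) 1 ∈ 𝓝[>] (0 : ℝ) := Ioo_mem_nhdsGT one_pos
  have tm : Tendsto (fun z : ℝ => z * y) (𝓝[>] 0) (𝓝[>] 0) := by
    refine tendsto_nhdsWithin_iff.2 ⟨?_, by filter_upwards [hI] with z hz using (hm z hz).1⟩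
    have : ContinuousAt (fun z : ℝ => z * y) 0 := by fun_prop
    simpa using this.tendsto.mono_left nhdsWithin_le_nhds
  have tu : Tendsto (fun z : ℝ => z * (1 - y) / (1 - z * y)) (𝓝[>] 0) (𝓝[>] 0) := by
    refine tendsto_nhdsWithin_iff.2 ⟨?_, by filter_upwards [hI] with z hz using (hu z hz).1⟩
    have : ContinuousAt (fun z : ℝ => z * (1 - y) / (1 - z * y)) 0 := by
      fun_prop (disch := simp)
    simpa using this.tendsto.mono_left nhdsWithin_le_nhds
  have tv : Tendsto (fun z : ℝ => y * (1 - z) / (1 - z * y)) (𝓝[>] 0) (𝓝 y) := by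
    have : ContinuousAt (fun z : ℝ => y * (1 - z) / (1 - z * y)) 0 := by
      fun_prop (disch := simp)
    simpa using this.tendsto.mono_left nhdsWithin_le_nhds
  have tg : Tendsto g (𝓝[>] 0) (𝓝 (0 - 0 - 0 - rogersL y)) :=
    ((tendsto_rogersL_zero.sub (tendsto_rogersL_zero.comp tm)).sub
      (tendsto_rogersL_zero.comp tu)).sub
      ((hasDerivAt_rogersL_s12 ⟨hy0, hy1⟩).continuousAt.tendsto.comp tv)
  have tc : Tendsto g (𝓝[>] 0) (𝓝 (g x)) := by
    refine tendsto_const_nhds.congr' ?_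
    filter_upwards [hI] with z hz using (hconst z hz).symm
  have := tendsto_nhds_unique tc tg
  simp only [hg] at this
  linarith

/-- A telescoping dilogarithm series, obtained by iterating the five-term relation. -/
lemma hasSum_rogersL_geometric {t : ℝ} (ht : t ∈ Ioo (0 : ℝ) 1) :
    HasSum (fun n : ℕ => rogersL ((1 - t) ^ 2 * t ^ (n + 1) / (1 - t ^ (n + 2)) ^ 2))
      (rogersL t) := by
  obtain ⟨ht0, ht1⟩ := ht
  have hp : ∀ n : ℕ, t ^ (n + 1) < 1 := fun n => pow_lt_one₀ ht0.le ht1 (by omega)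
  set x : ℕ → ℝ := fun n => (1 - t) / (1 - t ^ (n + 2)) with hx
  set y : ℕ → ℝ := fun n => (1 - t) * t ^ (n + 1) / (1 - t ^ (n + 2)) with hy
  have hq : ∀ n : ℕ, 0 < 1 - t ^ (n + 1) := fun n => by linarith [hp n]
  have hxm : ∀ n, x n ∈ Ioo (0 : ℝ) 1 := fun n => by
    refine ⟨div_pos (by linarith) (hq (n + 1)), ?_⟩
    rw [hx, div_lt_one (hq (n + 1))]
    have := mul_lt_mul_of_pos_left (hp n) ht0
    rw [pow_succ' t (n + 1)]
    linarith
  have hym : ∀ n, y n ∈ Ioo (0 : ℝ) 1 := fun n => by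
    refine ⟨div_pos (mul_pos (by linarith) (by positivity)) (hq (n + 1)), ?_⟩
    rw [hy, div_lt_one (hq (n + 1)), pow_succ' t (n + 1)]
    linarith [hp n]
  have hxy : ∀ n, x n * y n = (1 - t) ^ 2 * t ^ (n + 1) / (1 - t ^ (n + 2)) ^ 2 := fun n => by
    simp only [hx, hy]
    rw [div_mul_div_comm]
    ring
  have step : ∀ n, rogersL (x n * y n) =
      rogersL (x n) + rogersL (y n) - (rogersL (x (n + 1)) + rogersL (y (n + 1))) := fun n => by
    have h := rogersL_five_term (hxm n) (hym n)
    have h1 := (hq n).ne'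
    have h2 := (hq (n + 1)).ne'
    have h3 := (hq (n + 2)).ne'
    have hd : 1 - x n * y n =
        (1 - t ^ (n + 1)) * (1 - t ^ (n + 3)) / (1 - t ^ (n + 2)) ^ 2 := by
      rw [hxy, eq_div_iff (pow_ne_zero 2 h2), sub_mul, div_mul_cancel₀ _ (pow_ne_zero 2 h2)]
      ring
    have hx1 : 1 - x n = t * (1 - t ^ (n + 1)) / (1 - t ^ (n + 2)) := by
      simp only [hx]
      rw [eq_div_iff h2, sub_mul, div_mul_cancel₀ _ h2]
      ring
    have hy1 : 1 - y n = (1 - t ^ (n + 1)) / (1 - t ^ (n + 2)) := by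
      simp only [hy]
      rw [eq_div_iff h2, sub_mul, div_mul_cancel₀ _ h2]
      ring
    have e1 : x n * (1 - y n) / (1 - x n * y n) = x (n + 1) := by
      rw [hd, hy1]
      simp only [hx]
      generalize 1 - t ^ (n + 1) = a at *
      generalize 1 - t ^ (n + 2) = b at *
      change _ = (1 - t) / (1 - t ^ (n + 3))
      change 1 - t ^ (n + 3) ≠ 0 at h3
      field_simp
    have e2 : y n * (1 - x n) / (1 - x n * y n) = y (n + 1) := by
      rw [hd, hx1]
      simp only [hy]
      generalize 1 - t ^ (n + 1) = a at *
      generalize 1 - t ^ (n + 2) = b at *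
      change _ = (1 - t) * t ^ (n + 2) / (1 - t ^ (n + 3))
      change 1 - t ^ (n + 3) ≠ 0 at h3
      field_simp
      ring
    rw [e1, e2] at h
    linarith
  simp_rw [← hxy]
  have hmul : ∀ n, x n * y n ∈ Ioo (0 : ℝ) 1 := fun n =>
    ⟨mul_pos (hxm n).1 (hym n).1, mul_lt_one_of_nonneg_of_lt_one_left (hxm n).1.le (hxm n).2
      (hym n).2.le⟩
  rw [hasSum_iff_tendsto_nat_of_nonneg fun n => rogersL_nonneg_s12 (hmul n)]
  have hsum : ∀ N, ∑ n ∈ Finset.range N, rogersL (x n * y n) =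
      rogersL (x 0) + rogersL (y 0) - (rogersL (x N) + rogersL (y N)) := fun N => by
    simp_rw [step]
    exact Finset.sum_range_sub' (fun n => rogersL (x n) + rogersL (y n)) N
  simp_rw [hsum]
  have tp : ∀ k : ℕ, Tendsto (fun n : ℕ => t ^ (n + k)) atTop (𝓝 0) := fun k =>
    (tendsto_pow_atTop_nhds_zero_of_lt_one ht0.le ht1).comp (tendsto_add_atTop_nat k)
  have tx : Tendsto x atTop (𝓝 (1 - t)) := by
    simpa [hx, Pi.div_def] using (tendsto_const_nhds (x := 1 - t)).div ((tp 2).const_sub 1) (by simp)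
  have ty : Tendsto y atTop (𝓝[>] 0) := by
    refine tendsto_nhdsWithin_iff.2 ⟨?_, Eventually.of_forall fun n => (hym n).1⟩
    simpa [hy, Pi.div_def] using ((tp 1).const_mul (1 - t)).div ((tp 2).const_sub 1) (by simp)
  have ht' : 1 - t ∈ Ioo (0 : ℝ) 1 := ⟨by linarith, by linarith⟩
  have hlim := (((hasDerivAt_rogersL_s12 ht').continuousAt.tendsto.comp tx).add
    (tendsto_rogersL_zero.comp ty)).const_sub (rogersL (x 0) + rogersL (y 0))
  have hy0 : y 0 = 1 - x 0 := by
    have := (hq 1).ne'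
    simp only [hx, hy]
    rw [eq_sub_iff_add_eq, ← add_div, div_eq_one_iff_eq this]
    ring
  have h0 := rogersL_add_rogersL_one_sub (hxm 0) ⟨ht0, ht1⟩
  rw [← hy0] at h0
  have hL : rogersL (x 0) + rogersL (y 0) - (rogersL (1 - t) + 0) = rogersL t := by
    linarith
  rwa [hL] at hlim

lemma one_div_fib_two_mul_sq (n : ℕ) :
    1 / (Nat.fib (2 * (n + 2)) : ℝ) ^ 2 =
      (1 - goldenConj ^ 4) ^ 2 * (goldenConj ^ 4) ^ (n + 1) /
        (1 - (goldenConj ^ 4) ^ (n + 2)) ^ 2 := by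
  have h5 : (1 - goldenConj ^ 4) ^ 2 = 5 * goldenConj ^ 4 := by
    have h : goldenConj ^ 4 = 3 * goldenConj + 2 := by
      linear_combination (goldenConj ^ 2 + goldenConj + 2) * goldenConj_sq
    rw [h]
    linear_combination 9 * goldenConj_sq
  have hψ : goldenConj ^ (2 * (n + 2)) ≠ 0 := pow_ne_zero _ goldenConj_ne_zero
  have hφ : goldenRatio ^ (2 * (n + 2)) = (goldenConj ^ (2 * (n + 2)))⁻¹ := by
    rw [← mul_eq_one_iff_eq_inv₀ hψ, ← mul_pow, goldenRatio_mul_goldenConj, pow_mul]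
    simp
  have hp : (goldenConj ^ 4) ^ (n + 2) = (goldenConj ^ (2 * (n + 2))) ^ 2 := by
    rw [← pow_mul, ← pow_mul]
    ring_nf
  rw [h5, mul_assoc, ← pow_succ', hp, coe_fib_eq, hφ, div_pow, sq_sqrt (by norm_num)]
  generalize goldenConj ^ (2 * (n + 2)) = p at *
  have : (p⁻¹ - p) ^ 2 = (1 - p ^ 2) ^ 2 / p ^ 2 := by
    field_simp
  rw [this, one_div_div, div_div_eq_mul_div]

lemma two_div_seven_add_three_mul_sqrt_five : 2 / (7 + 3 * √5) = goldenConj ^ 4 := by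
  have h5 : √5 ^ 2 = 5 := sq_sqrt (by norm_num)
  rw [div_eq_iff (by positivity), goldenConj]
  generalize √5 = s at *
  have h4 : ((1 - s) / 2) ^ 4 = (7 - 3 * s) / 2 := by
    linear_combination ((s ^ 2 - 4 * s + 11) / 16) * h5
  rw [h4]
  linear_combination (9 / 2) * h5

theorem stmt_12 :
    ∑' n : ℕ, rogersL (1 / (Nat.fib (2 * (n + 2)) : ℝ) ^ 2) =
      rogersL (2 / (7 + 3 * Real.sqrt 5)) := by
  have ht : goldenConj ^ 4 ∈ Ioo (0 : ℝ) 1 := by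
    rw [← two_div_seven_add_three_mul_sqrt_five]
    refine ⟨by positivity, ?_⟩
    rw [div_lt_one (by positivity)]
    linarith [sqrt_nonneg (5 : ℝ)]
  simp_rw [one_div_fib_two_mul_sq, two_div_seven_add_three_mul_sqrt_five]
  exact (hasSum_rogersL_geometric ht).tsum_eq
end
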